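/- Let (X,G) be a G-complete G-metric space and T : X → X a mapping. Suppose there exists a subset B ⊆ X such that: (i) T(B) ⊆ B; (ii) there exists λ ∈ (0,1) such that for each x ∈ B there is a positive integer n(x) ≥ 1 with G(T^{n(x)} x, T^{n(x)} y, T^{n(x)} z) ≤ λ · G(x, y, z) for all y, z ∈ B; (iii) for some x_0 ∈ B, the closure (in the topology generated by G) of the set {T^n x_0 : n ≥ 1} is contained in B. Then there exists a unique ξ ∈ B with T ξ = ξ, and for each x_0 ∈ B the sequence (T^n x_0) G-converges to ξ. -/

import Mathlib

/-- A G-metric on a set `X`: a function `G : X × X × X → [0,∞)` satisfying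
(G1) `G x x x = 0`; (G2) `G x x y > 0` for `x ≠ y`; (G3) `G x x y ≤ G x y z` for `z ≠ y`;
(G4) symmetry in all three variables; (G5) `G x y z ≤ G x a a + G a y z`. -/
def IsGMetric {X : Type*} (G : X → X → X → ℝ) : Prop :=
  (∀ x y z, 0 ≤ G x y z) ∧
  (∀ x, G x x x = 0) ∧
  (∀ x y, x ≠ y → 0 < G x x y) ∧
  (∀ x y z, z ≠ y → G x x y ≤ G x y z) ∧
  (∀ x y z, G x y z = G x z y) ∧
  (∀ x y z, G x y z = G y z x) ∧
  (∀ x y z a, G x y z ≤ G x a a + G a y z)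

/-- A sequence `s` G-converges to `x` iff `G x (s n) (s n) → 0`. -/
def GConvergesTo {X : Type*} (G : X → X → X → ℝ) (s : ℕ → X) (x : X) : Prop :=
  Filter.Tendsto (fun n => G x (s n) (s n)) Filter.atTop (nhds 0)

/-- A sequence `s` is G-Cauchy iff for every `ε > 0` there is `N` with
`G (s n) (s m) (s m) < ε` for all `m, n ≥ N`. -/
def IsGCauchy {X : Type*} (G : X → X → X → ℝ) (s : ℕ → X) : Prop :=
  ∀ ε > (0 : ℝ), ∃ N : ℕ, ∀ m ≥ N, ∀ n ≥ N, G (s n) (s m) (s m) < ε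

/-- `(X, G)` is G-complete iff every G-Cauchy sequence G-converges to some point. -/
def IsGComplete {X : Type*} (G : X → X → X → ℝ) : Prop :=
  ∀ s : ℕ → X, IsGCauchy G s → ∃ x, GConvergesTo G s x

/-- `T` is G-continuous iff it maps G-convergent sequences to G-convergent sequences. -/
def IsGContinuous {X : Type*} (G : X → X → X → ℝ) (T : X → X) : Prop :=
  ∀ (s : ℕ → X) (x : X), GConvergesTo G s x → GConvergesTo G (fun n => T (s n)) (T x)

open Filter Topology

theorem tendsto_zero_of_add_le_mul {a : ℕ → ℝ} {r : ℝ} {n : ℕ} (ha : ∀ k, 0 ≤ a k)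
    (hr0 : 0 ≤ r) (hr1 : r < 1) (hn : 1 ≤ n) (h : ∀ k, a (k + n) ≤ r * a k) :
    Tendsto a atTop (𝓝 0) := by
  have hpow : ∀ j i, a (i + n * j) ≤ r ^ j * a i := by
    intro j i
    induction j with
    | zero => simp
    | succ j ih =>
      calc a (i + n * (j + 1)) = a (i + n * j + n) := by rw [mul_add_one, add_assoc]
        _ ≤ r * a (i + n * j) := h _
        _ ≤ r * (r ^ j * a i) := mul_le_mul_of_nonneg_left ih hr0
        _ = r ^ (j + 1) * a i := by ring
  have hbound : ∀ k, a k ≤ r ^ (k / n) * ∑ i ∈ Finset.range n, a i := by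
    intro k
    have hk := hpow (k / n) (k % n)
    rw [Nat.mod_add_div] at hk
    refine hk.trans (mul_le_mul_of_nonneg_left ?_ (pow_nonneg hr0 _))
    exact Finset.single_le_sum (fun i _ => ha i) (Finset.mem_range.2 (Nat.mod_lt _ hn))
  have hlim : Tendsto (fun k => r ^ (k / n) * ∑ i ∈ Finset.range n, a i) atTop (𝓝 0) := by
    simpa using ((tendsto_pow_atTop_nhds_zero_of_lt_one hr0 hr1).comp
      (Nat.tendsto_div_const_atTop (by omega : n ≠ 0))).mul_const _
  exact squeeze_zero ha hbound hlim

theorem exists_forall_le_of_add_le_mul_add {a : ℕ → ℝ} {r c : ℝ} {n : ℕ} (ha : ∀ k, 0 ≤ a k)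
    (hr0 : 0 ≤ r) (hr1 : r < 1) (hc : 0 ≤ c) (hn : 1 ≤ n)
    (h : ∀ k, a (k + n) ≤ r * a k + c) : ∃ R, ∀ k, a k ≤ R := by
  have hr : 0 < 1 - r := by linarith
  set M := c + ∑ i ∈ Finset.range n, a i
  have hsum : 0 ≤ ∑ i ∈ Finset.range n, a i := Finset.sum_nonneg fun i _ => ha i
  have hM0 : 0 ≤ M := by positivity
  have hR : r * (M / (1 - r)) + M = M / (1 - r) := by field_simp; ring
  have hR0 : 0 ≤ M / (1 - r) := by positivity
  refine ⟨M / (1 - r), fun k => ?_⟩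
  induction k using Nat.strong_induction_on with
  | _ k ih =>
    rcases lt_or_ge k n with hk | hk
    · have := Finset.single_le_sum (fun i _ => ha i) (Finset.mem_range.2 hk)
      nlinarith [mul_nonneg hr0 hR0]
    · have hstep := h (k - n)
      rw [Nat.sub_add_cancel hk] at hstep
      have := mul_le_mul_of_nonneg_left (ih (k - n) (by omega)) hr0
      linarith

section PointwisePowerContraction

variable {X : Type*} [MetricSpace X] {T : X → X} {B : Set X} {r : ℝ}

theorem exists_dist_iterate_self_le (hTB : Set.MapsTo T B B) (hr0 : 0 ≤ r) (hr1 : r < 1)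
    {x : X} (hx : x ∈ B) {n : ℕ} (hn : 1 ≤ n)
    (h : ∀ y ∈ B, dist (T^[n] x) (T^[n] y) ≤ r * dist x y) :
    ∃ R, ∀ k, dist x (T^[k] x) ≤ R := by
  refine exists_forall_le_of_add_le_mul_add (c := dist x (T^[n] x)) (n := n)
    (fun _ => dist_nonneg) hr0 hr1 dist_nonneg hn fun k => ?_
  have hk := h _ (hTB.iterate k hx)
  rw [← Function.iterate_add_apply, add_comm n k] at hk
  linarith [dist_triangle x (T^[n] x) (T^[k + n] x)]

theorem cauchySeq_iterate_of_pointwise_power_contraction (hTB : Set.MapsTo T B B)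
    (hr0 : 0 ≤ r) (hr1 : r < 1)
    (h : ∀ x ∈ B, ∃ n : ℕ, 1 ≤ n ∧ ∀ y ∈ B, dist (T^[n] x) (T^[n] y) ≤ r * dist x y)
    {x : X} (hx : x ∈ B) : CauchySeq fun m => T^[m] x := by
  obtain ⟨n, hn, hnx⟩ := h x hx
  obtain ⟨R, hR⟩ := exists_dist_iterate_self_le hTB hr0 hr1 hx hn hnx
  have htail : ∀ i : ℕ, ∃ m, ∀ k, dist (T^[m] x) (T^[k + m] x) ≤ r ^ i * R := by
    intro i
    induction i with
    | zero => exact ⟨0, by simpa using hR⟩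
    | succ i ih =>
      obtain ⟨m, hm⟩ := ih
      obtain ⟨p, -, hp⟩ := h _ (hTB.iterate m hx)
      refine ⟨p + m, fun k => ?_⟩
      have hk := hp _ (hTB.iterate (k + m) hx)
      rw [← Function.iterate_add_apply, ← Function.iterate_add_apply, add_left_comm] at hk
      calc _ ≤ r * dist (T^[m] x) (T^[k + m] x) := hk
        _ ≤ r * (r ^ i * R) := mul_le_mul_of_nonneg_left (hm k) hr0
        _ = r ^ (i + 1) * R := by ring
  have hlim : Tendsto (fun i : ℕ => r ^ i * R) atTop (𝓝 0) := by
    simpa using (tendsto_pow_atTop_nhds_zero_of_lt_one hr0 hr1).mul_const R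
  refine Metric.cauchySeq_iff'.2 fun ε hε => ?_
  obtain ⟨i, hi⟩ := (hlim.eventually_lt_const hε).exists
  obtain ⟨m, hm⟩ := htail i
  refine ⟨m, fun k hk => ?_⟩
  have hkm := hm (k - m)
  rw [Nat.sub_add_cancel hk, dist_comm] at hkm
  exact hkm.trans_lt hi

/-- Guseman's fixed point theorem: a self-map of an invariant set `B` such that at each point of
`B` some power of it contracts distances to that point has a unique fixed point in `B`, provided
the limit of some orbit lies in `B`. -/
theorem exists_unique_fixedPoint_of_pointwise_power_contraction [CompleteSpace X]
    (hTB : Set.MapsTo T B B) (hr0 : 0 ≤ r) (hr1 : r < 1)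
    (h : ∀ x ∈ B, ∃ n : ℕ, 1 ≤ n ∧ ∀ y ∈ B, dist (T^[n] x) (T^[n] y) ≤ r * dist x y)
    {x : X} (hx : x ∈ B) (hlim : ∀ p, Tendsto (fun m => T^[m] x) atTop (𝓝 p) → p ∈ B) :
    ∃ ξ ∈ B, T ξ = ξ ∧ (∀ η ∈ B, T η = η → η = ξ) ∧
      ∀ y ∈ B, Tendsto (fun k => T^[k] y) atTop (𝓝 ξ) := by
  obtain ⟨ξ, hξ⟩ := cauchySeq_tendsto_of_complete
    (cauchySeq_iterate_of_pointwise_power_contraction hTB hr0 hr1 h hx)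
  have hξB := hlim ξ hξ
  obtain ⟨n, hn, hc⟩ := h ξ hξB
  have hpow : T^[n] ξ = ξ := by
    refine tendsto_nhds_unique ?_ ((tendsto_add_atTop_iff_nat n).2 hξ)
    have hd := (tendsto_iff_dist_tendsto_zero.1 hξ).const_mul r
    rw [mul_zero] at hd
    refine tendsto_iff_dist_tendsto_zero.2 (squeeze_zero (fun _ => dist_nonneg) (fun k => ?_) hd)
    have hk := hc _ (hTB.iterate k hx)
    rwa [← Function.iterate_add_apply, add_comm n k, dist_comm, dist_comm ξ] at hk
  have huniq : ∀ η ∈ B, T^[n] η = η → η = ξ := by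
    intro η hη hfix
    have hd := hc η hη
    rw [hpow, hfix] at hd
    refine (dist_le_zero.1 ?_).symm
    nlinarith [dist_nonneg (x := ξ) (y := η)]
  refine ⟨ξ, hξB, huniq _ (hTB hξB) ?_, fun η hη hfix => huniq η hη (Function.iterate_fixed hfix n),
    fun y hy => ?_⟩
  · rw [← Function.iterate_succ_apply, Function.iterate_succ_apply', hpow]
  · refine tendsto_iff_dist_tendsto_zero.2
      (tendsto_zero_of_add_le_mul (fun _ => dist_nonneg) hr0 hr1 hn fun k => ?_)
    have hk := hc _ (hTB.iterate k hy)
    rwa [hpow, ← Function.iterate_add_apply, add_comm n k, dist_comm, dist_comm ξ] at hk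

end PointwisePowerContraction

namespace IsGMetric

variable {X : Type*} {G : X → X → X → ℝ}

theorem nonneg (hG : IsGMetric G) (x y z : X) : 0 ≤ G x y z := hG.1 x y z

theorem self_eq_zero (hG : IsGMetric G) (x : X) : G x x x = 0 := hG.2.1 x

theorem pos_of_ne (hG : IsGMetric G) {x y : X} (hxy : x ≠ y) : 0 < G x x y := hG.2.2.1 x y hxy

theorem rotate (hG : IsGMetric G) (x y z : X) : G x y z = G y z x := hG.2.2.2.2.2.1 x y z

theorem triangle (hG : IsGMetric G) (x y z a : X) : G x y z ≤ G x a a + G a y z :=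
  hG.2.2.2.2.2.2 x y z a

theorem le_two_mul (hG : IsGMetric G) (x y : X) : G x y y ≤ 2 * G y x x := by
  linarith [hG.triangle y y x x, hG.rotate x y y, hG.rotate y x x, hG.rotate x y x]

/-- The metric `G x y y + G y x x` associated with a G-metric. -/
@[reducible] noncomputable def toMetricSpace (hG : IsGMetric G) : MetricSpace X where
  dist x y := G x y y + G y x x
  dist_self x := by simp [hG.self_eq_zero]
  dist_comm x y := add_comm _ _
  dist_triangle x y z := by
    linarith [hG.triangle x z z y, hG.triangle z x x y]
  eq_of_dist_eq_zero {x y} hxy := by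
    by_contra hne
    replace hxy : G x y y + G y x x = 0 := hxy
    linarith [hG.pos_of_ne hne, hG.rotate y x x, hG.nonneg x y y]

theorem tendsto_iff_gConvergesTo (hG : IsGMetric G) {s : ℕ → X} {x : X} :
    letI := hG.toMetricSpace
    Tendsto s atTop (𝓝 x) ↔ GConvergesTo G s x := by
  let := hG.toMetricSpace
  have hdist : ∀ n, dist (s n) x = G (s n) x x + G x (s n) (s n) := fun _ => rfl
  rw [tendsto_iff_dist_tendsto_zero]
  constructor
  · refine fun hs => squeeze_zero (fun n => hG.nonneg _ _ _) (fun n => ?_) hs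
    linarith [hdist n, hG.nonneg (s n) x x]
  · intro hs
    have hs3 := Tendsto.const_mul 3 hs
    rw [mul_zero] at hs3
    refine squeeze_zero (fun _ => dist_nonneg) (fun n => ?_) hs3
    linarith [hdist n, hG.le_two_mul (s n) x]

theorem completeSpace (hG : IsGMetric G) (hcomp : IsGComplete G) :
    letI := hG.toMetricSpace
    CompleteSpace X := by
  let := hG.toMetricSpace
  refine Metric.complete_of_cauchySeq_tendsto fun s hs => ?_
  obtain ⟨x, hx⟩ := hcomp s fun ε hε => by
    obtain ⟨N, hN⟩ := Metric.cauchySeq_iff.1 hs ε hε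
    refine ⟨N, fun m hm n hn => lt_of_le_of_lt ?_ (hN n hn m hm)⟩
    exact le_add_of_nonneg_right (hG.nonneg _ _ _)
  exact ⟨x, hG.tendsto_iff_gConvergesTo.2 hx⟩

end IsGMetric

/-- **Theorem.** Let `(X,G)` be G-complete, `B ⊆ X` with (i) `T(B) ⊆ B`;
(ii) for some `λ ∈ (0,1)` and each `x ∈ B` there is `n(x) ≥ 1` with
`G(T^[n x] x, T^[n x] y, T^[n x] z) ≤ λ G(x,y,z)` for all `y, z ∈ B`;
(iii) for some `x₀ ∈ B` the G-closure of `{T^m x₀ : m ≥ 1}` is contained in `B`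
(a point is in the G-closure of `S` iff some sequence in `S` G-converges to it).
Then `T` has a unique fixed point `ξ` in `B` and `(T^k y₀)_{k ≥ 1}` G-converges to
`ξ` for every `y₀ ∈ B`. -/
theorem gmetric_power_contraction_on_subset {X : Type*} [Nonempty X]
    (G : X → X → X → ℝ) (hG : IsGMetric G) (hcomp : IsGComplete G)
    (T : X → X) (B : Set X) (hTB : Set.MapsTo T B B)
    (lam : ℝ) (hlam0 : 0 < lam) (hlam1 : lam < 1)
    (h : ∀ x ∈ B, ∃ n : ℕ, 1 ≤ n ∧ ∀ y ∈ B, ∀ z ∈ B,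
      G (T^[n] x) (T^[n] y) (T^[n] z) ≤ lam * G x y z)
    (x0 : X) (hx0 : x0 ∈ B)
    (hcl : ∀ p : X, (∃ s : ℕ → X, (∀ j, ∃ m : ℕ, 1 ≤ m ∧ s j = T^[m] x0) ∧
      GConvergesTo G s p) → p ∈ B) :
    ∃ ξ ∈ B, T ξ = ξ ∧ (∀ η ∈ B, T η = η → η = ξ) ∧
      ∀ y0 ∈ B, GConvergesTo G (fun k => T^[k + 1] y0) ξ := by
  let := hG.toMetricSpace
  have := hG.completeSpace hcomp
  have hcontr : ∀ x ∈ B, ∃ n : ℕ, 1 ≤ n ∧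
      ∀ y ∈ B, dist (T^[n] x) (T^[n] y) ≤ lam * dist x y := by
    intro x hx
    obtain ⟨n, hn, hc⟩ := h x hx
    refine ⟨n, hn, fun y hy => ?_⟩
    change G _ _ _ + G _ _ _ ≤ lam * (G _ _ _ + G _ _ _)
    rw [hG.rotate (T^[n] y), hG.rotate y, mul_add]
    exact add_le_add (hc y hy y hy) (hc x hx y hy)
  obtain ⟨ξ, hξ, hfix, huniq, hconv⟩ := exists_unique_fixedPoint_of_pointwise_power_contraction
    hTB hlam0.le hlam1 hcontr hx0 fun p hp =>
      hcl p ⟨fun j => T^[j + 1] x0, fun j => ⟨j + 1, by omega, rfl⟩,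
        hG.tendsto_iff_gConvergesTo.1 ((tendsto_add_atTop_iff_nat 1).2 hp)⟩
  exact ⟨ξ, hξ, hfix, huniq, fun y hy =>
    hG.tendsto_iff_gConvergesTo.1 ((tendsto_add_atTop_iff_nat 1).2 (hconv y hy))⟩
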